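/- For all μ₁, μ₂ ∈ ℕ and 0 ≤ i ≤ min(μ₁,μ₂): R v_i^{μ₁,μ₂} = (−1)^{i}·q^{(μ₁−i)(μ₂−i)−i}·v_i^{μ₂,μ₁}. -/

import Mathlib

/-- The variable `q` in the field `ℚ(q)` of rational functions. -/
noncomputable def qq : RatFunc ℚ := RatFunc.X

/-- The quantum integer `[m] = ∑_{s=0}^{m-1} q^{m-1-2s} = (q^m - q^{-m})/(q - q^{-1})`. -/
noncomputable def qint (m : ℕ) : RatFunc ℚ :=
  ∑ s ∈ Finset.range m, qq ^ ((m : ℤ) - 1 - 2 * (s : ℤ))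

/-- The quantum factorial `[m]! = [m][m-1]⋯[1]`. -/
noncomputable def qfact (m : ℕ) : RatFunc ℚ :=
  ∏ r ∈ Finset.range m, qint (r + 1)

/-- The quantum binomial coefficient `[m]!/([a]![m-a]!)`. -/
noncomputable def qbinom (m a : ℕ) : RatFunc ℚ :=
  qfact m / (qfact a * qfact (m - a))

/-- The `ℚ(q)`-vector space with basis `X^m` indexed by the exponent functions
`m : Fin k × Fin 2 → ℕ` (rows `1,…,k` and two columns, 0-indexed). -/
abbrev Mmod (k : ℕ) := (Fin k × Fin 2 → ℕ) →₀ RatFunc ℚ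

/-- The basis vector `X^m` of `Mmod k`. -/
noncomputable def Xb {k : ℕ} (m : Fin k × Fin 2 → ℕ) : Mmod k :=
  Finsupp.single m 1

/-- A linear operator on `Mmod k` defined by its values on the basis `X^m`. -/
noncomputable def mkOp {k : ℕ} (f : (Fin k × Fin 2 → ℕ) → Mmod k) :
    Mmod k →ₗ[RatFunc ℚ] Mmod k :=
  Finsupp.lift (Mmod k) (RatFunc ℚ) (Fin k × Fin 2 → ℕ) f

/-- The exponent function `m + ε_p − ε_{p'}` (with truncated subtraction; in all
formulas below a term whose exponent function fails to be `ℕ`-valued carries a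
vanishing coefficient `[0] = 0`). -/
def shiftExp {k : ℕ} (m : Fin k × Fin 2 → ℕ) (pup pdown : Fin k × Fin 2) :
    Fin k × Fin 2 → ℕ :=
  fun p => m p + (if p = pup then 1 else 0) - (if p = pdown then 1 else 0)

/-- The highest weight vector
`v_i^{μ₁,μ₂} = ∑_{a=0}^{i} (−1)^a qbinom(i,a) q^{a(μ₂−a+1)} X^{m(a)}`, where
`m(a)_{1,1} = μ₁−i+a`, `m(a)_{2,1} = i−a`, `m(a)_{1,2} = μ₂−a`,
`m(a)_{2,2} = a` and `m(a)` vanishes on rows `≥ 3`. -/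
noncomputable def vvec {k : ℕ} (hk : 2 ≤ k) (μ₁ μ₂ i : ℕ) : Mmod k :=
  ∑ a ∈ Finset.range (i + 1),
    ((-1) ^ a * qbinom i a * qq ^ (a * (μ₂ - a + 1))) •
      Xb (fun p =>
        if p = ((⟨0, by omega⟩ : Fin k), (0 : Fin 2)) then μ₁ - i + a
        else if p = ((⟨1, by omega⟩ : Fin k), (0 : Fin 2)) then i - a
        else if p = ((⟨0, by omega⟩ : Fin k), (1 : Fin 2)) then μ₂ - a
        else if p = ((⟨1, by omega⟩ : Fin k), (1 : Fin 2)) then a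
        else 0)

/-- The quantum-plane raising operator in the first column:
`E' X^m = [m_{2,1}] X^{m+ε_{1,1}−ε_{2,1}}`. -/
noncomputable def Eop' {k : ℕ} (hk : 2 ≤ k) : Mmod k →ₗ[RatFunc ℚ] Mmod k :=
  mkOp fun m =>
    qint (m ((⟨1, by omega⟩ : Fin k), 0)) •
      Xb (shiftExp m ((⟨0, by omega⟩ : Fin k), 0) ((⟨1, by omega⟩ : Fin k), 0))

/-- The lowering operator in the second column:
`F'' X^m = [m_{1,2}] X^{m−ε_{1,2}+ε_{2,2}}`. -/
noncomputable def Fop'' {k : ℕ} (hk : 2 ≤ k) : Mmod k →ₗ[RatFunc ℚ] Mmod k :=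
  mkOp fun m =>
    qint (m ((⟨0, by omega⟩ : Fin k), 1)) •
      Xb (shiftExp m ((⟨1, by omega⟩ : Fin k), 1) ((⟨0, by omega⟩ : Fin k), 1))

/-- The Cartan factor `Q X^m = q^{∑_a m_{a,1} m_{a,2}} X^m`. -/
noncomputable def Qop (k : ℕ) : Mmod k →ₗ[RatFunc ℚ] Mmod k :=
  mkOp fun m => (qq ^ (∑ a : Fin k, m (a, 0) * m (a, 1))) • Xb m

/-- The column flip `τ X^m = X^{m^σ}`, `m^σ_{i,1} = m_{i,2}`, `m^σ_{i,2} = m_{i,1}`. -/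
noncomputable def tauOp (k : ℕ) : Mmod k →ₗ[RatFunc ℚ] Mmod k :=
  mkOp fun m => Xb fun p => m (p.1, if p.2 = 0 then 1 else 0)

/-- The total degree of the exponents occurring in `v`. -/
def tdeg {k : ℕ} (v : Mmod k) : ℕ :=
  v.support.sup fun m => ∑ p : Fin k × Fin 2, m p

/-- The gl-normalized `R`-matrix operator (reduced to the two relevant
simple-root factors):
`R = τ ∘ Q ∘ (∑_{n ≥ 0} q^{n(n−1)/2} ((q−q^{−1})^n/[n]!) (E')^n ∘ (F'')^n)`,
applied to a vector of `Mmod k`; the sum is finite on each vector, all terms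
with `n > tdeg v` vanishing since `E'`, `F''` are locally nilpotent. -/
noncomputable def Rapp {k : ℕ} (hk : 2 ≤ k) (v : Mmod k) : Mmod k :=
  tauOp k (Qop k
    (∑ n ∈ Finset.range (tdeg v + 1),
      (qq ^ (n * (n - 1) / 2) * ((qq - qq⁻¹) ^ n / qfact n)) •
        ((Eop' hk ^ n) ((Fop'' hk ^ n) v))))

lemma qq_ne_zero : qq ≠ 0 := RatFunc.X_ne_zero

lemma qq_pow_ne_one {n : ℕ} (hn : n ≠ 0) : qq ^ n ≠ 1 := by
  intro h
  have h' : algebraMap (Polynomial ℚ) (RatFunc ℚ) (Polynomial.X ^ n) =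
      algebraMap (Polynomial ℚ) (RatFunc ℚ) 1 := by
    simpa [qq] using h
  have h'' := congrArg Polynomial.natDegree (RatFunc.algebraMap_injective ℚ h')
  simp at h''
  exact hn h''

lemma qq_sub_inv_ne_zero : qq - qq⁻¹ ≠ 0 := by
  intro h
  have hq := qq_ne_zero
  refine qq_pow_ne_one two_ne_zero ?_
  field_simp at h
  linear_combination h

lemma qint_mul (m : ℕ) : qint m * (qq - qq⁻¹) = qq ^ m - (qq ^ m)⁻¹ := by
  have hq := qq_ne_zero
  have h : ∀ n : ℕ, (∑ s ∈ Finset.range n, qq ^ ((m : ℤ) - 1 - 2 * (s : ℤ))) * (qq - qq⁻¹) =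
      qq ^ (m : ℤ) - qq ^ ((m : ℤ) - 2 * n) := by
    intro n
    induction n with
    | zero => simp
    | succ n ih =>
      rw [Finset.sum_range_succ, add_mul, ih]
      have h1 : (m : ℤ) - 2 * n = ((m : ℤ) - 1 - 2 * n) + 1 := by ring
      have h2 : (m : ℤ) - 2 * (n + 1 : ℕ) = ((m : ℤ) - 1 - 2 * n) - 1 := by push_cast; ring
      rw [h1, h2, zpow_add_one₀ hq, zpow_sub_one₀ hq]
      ring
  rw [qint, h m, ← zpow_natCast, ← zpow_neg]
  congr 2
  ring

lemma qint_zero : qint 0 = 0 := by simp [qint]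

lemma qint_ne_zero {m : ℕ} (hm : m ≠ 0) : qint m ≠ 0 := by
  intro h
  have h1 := qint_mul m
  have hq := pow_ne_zero m qq_ne_zero
  rw [h, zero_mul] at h1
  refine qq_pow_ne_one (n := m * 2) (by omega) ?_
  rw [pow_mul]
  field_simp at h1
  linear_combination -h1

lemma qint_add_succ (n c : ℕ) :
    qint (n + c) = (qq ^ n)⁻¹ * qint c + qq ^ c * qint n := by
  have hq := qq_ne_zero
  apply mul_right_cancel₀ qq_sub_inv_ne_zero
  rw [add_mul, mul_assoc, mul_assoc, qint_mul, qint_mul, qint_mul, pow_add]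
  field_simp
  ring

lemma qfact_zero : qfact 0 = 1 := by simp [qfact]

lemma qfact_succ (m : ℕ) : qfact (m + 1) = qfact m * qint (m + 1) := by
  rw [qfact, Finset.prod_range_succ, ← qfact]

lemma qfact_ne_zero (m : ℕ) : qfact m ≠ 0 :=
  Finset.prod_ne_zero_iff.mpr fun _ _ => qint_ne_zero (Nat.succ_ne_zero _)

lemma qbinom_zero (m : ℕ) : qbinom m 0 = 1 := by
  simp [qbinom, qfact_zero, qfact_ne_zero]

lemma qbinom_self (m : ℕ) : qbinom m m = 1 := by
  simp [qbinom, qfact_zero, qfact_ne_zero]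

lemma qbinom_add (n c : ℕ) : qbinom (n + c) n = qfact (n + c) / (qfact n * qfact c) := by
  simp [qbinom]

lemma qbinom_symm {m a : ℕ} (h : a ≤ m) : qbinom m (m - a) = qbinom m a := by
  rw [qbinom, qbinom, Nat.sub_sub_self h, mul_comm (qfact a)]

lemma qbinom_pascal (n c : ℕ) :
    qbinom (n + c + 2) (n + 1) =
      (qq ^ (n + 1))⁻¹ * qbinom (n + c + 1) (n + 1) + qq ^ (c + 1) * qbinom (n + c + 1) n := by
  have e1 : n + c + 2 = (n + 1) + (c + 1) := by ring
  have e2 : qbinom (n + c + 1) (n + 1) = qfact (n + c + 1) / (qfact (n + 1) * qfact c) := by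
    rw [show n + c + 1 = (n + 1) + c by ring, qbinom_add]
  have e3 : qbinom (n + c + 1) n = qfact (n + c + 1) / (qfact n * qfact (c + 1)) :=
    qbinom_add n (c + 1)
  rw [e2, e3, e1, qbinom_add, show n + 1 + (c + 1) = (n + c + 1) + 1 by ring,
    qfact_succ (n + c + 1), show n + c + 1 + 1 = (n + 1) + (c + 1) by ring, qint_add_succ,
    qfact_succ n, qfact_succ c]
  have h1 := qfact_ne_zero n
  have h2 := qfact_ne_zero c
  have h3 := qint_ne_zero (Nat.succ_ne_zero n)
  have h4 := qint_ne_zero (Nat.succ_ne_zero c)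
  have hq := qq_ne_zero
  field_simp

lemma qfact_div_mul_pow (M n : ℕ) :
    (qq - qq⁻¹) ^ n * (qfact (M + n) / qfact M) =
      ∏ r ∈ Finset.range n, (qq ^ (M + 1) * qq ^ r - (qq ^ (M + 1) * qq ^ r)⁻¹) := by
  induction n with
  | zero => simp [qfact_ne_zero]
  | succ n ih =>
    rw [Finset.prod_range_succ, ← ih, ← pow_add, show M + 1 + n = M + n + 1 by ring, ← qint_mul,
      ← add_assoc, qfact_succ]
    ring

/-- The summands of the alternating `q`-binomial identity `sum_altTerm`. -/
noncomputable def altTerm (b n : ℕ) (x : RatFunc ℚ) : RatFunc ℚ :=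
  (-1) ^ n * qbinom b n * x ^ (b - n) * qq ^ ((b - n) * n + n * (n - 1) / 2) *
    ∏ r ∈ Finset.range n, (x * qq ^ r - (x * qq ^ r)⁻¹)

lemma triangle_succ (n : ℕ) : (n + 1) * (n + 1 - 1) / 2 = n * (n - 1) / 2 + n := by
  rw [← Nat.choose_two_right, ← Nat.choose_two_right, Nat.choose_succ_succ' n 1]
  simp [add_comm]

lemma prod_sub_inv_succ (n : ℕ) (x : RatFunc ℚ) :
    ∏ r ∈ Finset.range (n + 1), (x * qq ^ r - (x * qq ^ r)⁻¹) =
      (x - x⁻¹) * ∏ r ∈ Finset.range n, (x * qq * qq ^ r - (x * qq * qq ^ r)⁻¹) := by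
  rw [Finset.prod_range_succ', mul_comm]
  simp [pow_succ', mul_assoc]

lemma altTerm_succ (n c : ℕ) (x : RatFunc ℚ) :
    altTerm (n + c + 2) (n + 1) x =
      x * altTerm (n + c + 1) (n + 1) x -
        (x - x⁻¹) * qq ^ (n + c + 1) * altTerm (n + c + 1) n (x * qq) := by
  have hq := qq_ne_zero
  unfold altTerm
  rw [prod_sub_inv_succ, triangle_succ, qbinom_pascal,
    show n + c + 2 - (n + 1) = c + 1 by omega, show n + c + 1 - (n + 1) = c by omega,
    show n + c + 1 - n = c + 1 by omega]
  generalize ∏ r ∈ Finset.range n, (x * qq * qq ^ r - (x * qq * qq ^ r)⁻¹) = P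
  generalize n * (n - 1) / 2 = t
  generalize x - x⁻¹ = d
  simp only [mul_pow, pow_add, add_mul, mul_add, pow_one, one_mul, mul_one]
  field_simp
  ring

lemma altTerm_self_succ (n : ℕ) (x : RatFunc ℚ) :
    altTerm (n + 1) (n + 1) x = -((x - x⁻¹) * qq ^ n * altTerm n n (x * qq)) := by
  unfold altTerm
  rw [prod_sub_inv_succ, triangle_succ, qbinom_self, qbinom_self]
  simp only [Nat.sub_self, zero_mul, zero_add, pow_add, pow_one, pow_zero]
  ring

lemma altTerm_zero_right (b : ℕ) (x : RatFunc ℚ) : altTerm b 0 x = x ^ b := by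
  simp [altTerm, qbinom_zero]

lemma sum_altTerm (b : ℕ) {x : RatFunc ℚ} (hx : x ≠ 0) :
    ∑ n ∈ Finset.range (b + 1), altTerm b n x = x⁻¹ ^ b := by
  induction b generalizing x with
  | zero => simp [altTerm_zero_right]
  | succ b ih =>
    have hq := qq_ne_zero
    have h : ∑ n ∈ Finset.range (b + 2), altTerm (b + 1) n x =
        x * (∑ n ∈ Finset.range (b + 1), altTerm b n x) -
          (x - x⁻¹) * qq ^ b * ∑ n ∈ Finset.range (b + 1), altTerm b n (x * qq) := by
      have hstep : ∑ n ∈ Finset.range b, altTerm (b + 1) (n + 1) x =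
          x * (∑ n ∈ Finset.range b, altTerm b (n + 1) x) -
            (x - x⁻¹) * qq ^ b * ∑ n ∈ Finset.range b, altTerm b n (x * qq) := by
        rw [Finset.mul_sum, Finset.mul_sum, ← Finset.sum_sub_distrib]
        refine Finset.sum_congr rfl fun n hn => ?_
        obtain ⟨c, rfl⟩ := Nat.exists_eq_add_of_lt (Finset.mem_range.mp hn)
        exact altTerm_succ n c x
      rw [Finset.sum_range_succ', Finset.sum_range_succ, hstep, altTerm_self_succ,
        Finset.sum_range_succ' (fun n => altTerm b n x),
        Finset.sum_range_succ (fun n => altTerm b n (x * qq)), altTerm_zero_right,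
        altTerm_zero_right]
      ring
    rw [h, ih hx, ih (mul_ne_zero hx hq)]
    simp only [mul_inv, mul_pow, inv_pow]
    field_simp
    ring

/-- The exponent function with entries `p, r` in the first two rows of the first column,
`s, t` in the first two rows of the second column, and zeros elsewhere. -/
def twoRowExp {k : ℕ} (hk : 2 ≤ k) (p r s t : ℕ) : Fin k × Fin 2 → ℕ := fun x =>
  if x = ((⟨0, by omega⟩ : Fin k), (0 : Fin 2)) then p
  else if x = ((⟨1, by omega⟩ : Fin k), (0 : Fin 2)) then r
  else if x = ((⟨0, by omega⟩ : Fin k), (1 : Fin 2)) then s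
  else if x = ((⟨1, by omega⟩ : Fin k), (1 : Fin 2)) then t
  else 0

section Operators

variable {k : ℕ} (hk : 2 ≤ k)

lemma mkOp_Xb (f : (Fin k × Fin 2 → ℕ) → Mmod k) (m : Fin k × Fin 2 → ℕ) :
    mkOp f (Xb m) = f m := by
  simp [mkOp, Xb]

lemma Eop'_Xb_succ (p r s t : ℕ) :
    Eop' hk (Xb (twoRowExp hk p (r + 1) s t)) =
      qint (r + 1) • Xb (twoRowExp hk (p + 1) r s t) := by
  rw [Eop', mkOp_Xb]
  congr 2
  funext x
  simp only [shiftExp, twoRowExp]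
  split_ifs <;> simp_all

lemma Eop'_Xb_zero (p s t : ℕ) : Eop' hk (Xb (twoRowExp hk p 0 s t)) = 0 := by
  rw [Eop', mkOp_Xb]
  simp [twoRowExp, qint_zero]

lemma Fop''_Xb_succ (p r s t : ℕ) :
    Fop'' hk (Xb (twoRowExp hk p r (s + 1) t)) =
      qint (s + 1) • Xb (twoRowExp hk p r s (t + 1)) := by
  rw [Fop'', mkOp_Xb]
  congr 2
  funext x
  simp only [shiftExp, twoRowExp]
  split_ifs <;> simp_all

lemma Fop''_Xb_zero (p r t : ℕ) : Fop'' hk (Xb (twoRowExp hk p r 0 t)) = 0 := by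
  rw [Fop'', mkOp_Xb]
  simp [twoRowExp, qint_zero]

lemma Eop'_pow_Xb (n p r s t : ℕ) :
    (Eop' hk ^ n) (Xb (twoRowExp hk p (r + n) s t)) =
      (qfact (r + n) / qfact r) • Xb (twoRowExp hk (p + n) r s t) := by
  induction n generalizing p with
  | zero => simp [qfact_ne_zero]
  | succ n ih =>
    rw [pow_succ, Module.End.mul_apply, ← add_assoc, Eop'_Xb_succ, map_smul, ih, smul_smul,
      qfact_succ, add_assoc p, add_comm 1 n]
    congr 1
    ring

lemma Fop''_pow_Xb (n p r s t : ℕ) :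
    (Fop'' hk ^ n) (Xb (twoRowExp hk p r (s + n) t)) =
      (qfact (s + n) / qfact s) • Xb (twoRowExp hk p r s (t + n)) := by
  induction n generalizing t with
  | zero => simp [qfact_ne_zero]
  | succ n ih =>
    rw [pow_succ, Module.End.mul_apply, ← add_assoc, Fop''_Xb_succ, map_smul, ih, smul_smul,
      qfact_succ, add_assoc t, add_comm 1 n]
    congr 1
    ring

lemma Eop'_pow_Xb_of_lt {n r : ℕ} (h : r < n) (p s t : ℕ) :
    (Eop' hk ^ n) (Xb (twoRowExp hk p r s t)) = 0 := by
  obtain ⟨c, rfl⟩ := Nat.exists_eq_add_of_lt h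
  have h1 := Eop'_pow_Xb hk r p 0 s t
  rw [zero_add] at h1
  rw [show r + c + 1 = c + 1 + r by ring, pow_add, Module.End.mul_apply, h1, map_smul, pow_succ,
    Module.End.mul_apply, Eop'_Xb_zero, map_zero, smul_zero]

lemma Fop''_pow_Xb_of_lt {n s : ℕ} (h : s < n) (p r t : ℕ) :
    (Fop'' hk ^ n) (Xb (twoRowExp hk p r s t)) = 0 := by
  obtain ⟨c, rfl⟩ := Nat.exists_eq_add_of_lt h
  have h1 := Fop''_pow_Xb hk s p r 0 t
  rw [zero_add] at h1
  rw [show s + c + 1 = c + 1 + s by ring, pow_add, Module.End.mul_apply, h1, map_smul, pow_succ,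
    Module.End.mul_apply, Fop''_Xb_zero, map_zero, smul_zero]

lemma Eop'_pow_Fop''_pow_Xb_of_lt {n r : ℕ} (h : r < n) (p s t : ℕ) :
    (Eop' hk ^ n) ((Fop'' hk ^ n) (Xb (twoRowExp hk p r s t))) = 0 := by
  rcases lt_or_ge s n with hs | hs
  · rw [Fop''_pow_Xb_of_lt hk hs, map_zero]
  · obtain ⟨s, rfl⟩ := Nat.exists_eq_add_of_le' hs
    rw [Fop''_pow_Xb, map_smul, Eop'_pow_Xb_of_lt hk h, smul_zero]

lemma Qop_Xb (p r s t : ℕ) :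
    Qop k (Xb (twoRowExp hk p r s t)) =
      qq ^ (p * s + r * t) • Xb (twoRowExp hk p r s t) := by
  rw [Qop, mkOp_Xb]
  obtain ⟨k, rfl⟩ := Nat.exists_eq_add_of_le' hk
  congr 2
  rw [Fin.sum_univ_succ, Fin.sum_univ_succ]
  simp [twoRowExp, Fin.ext_iff]

lemma tauOp_Xb (p r s t : ℕ) :
    tauOp k (Xb (twoRowExp hk p r s t)) = Xb (twoRowExp hk s t p r) := by
  rw [tauOp, mkOp_Xb]
  congr 1
  funext ⟨x, c⟩
  fin_cases c <;> simp [twoRowExp]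

/-- The exponent function `m(a)` of the definition of `vvec`. -/
def vexp (μ₁ μ₂ i a : ℕ) : Fin k × Fin 2 → ℕ :=
  twoRowExp hk (μ₁ - i + a) (i - a) (μ₂ - a) a

lemma vvec_eq (μ₁ μ₂ i : ℕ) :
    vvec hk μ₁ μ₂ i = ∑ a ∈ Finset.range (i + 1),
      ((-1) ^ a * qbinom i a * qq ^ (a * (μ₂ - a + 1))) • Xb (vexp hk μ₁ μ₂ i a) :=
  rfl

lemma vexp_eq_vexp_zero_iff (μ₁ μ₂ i a : ℕ) : vexp hk μ₁ μ₂ i a = vexp hk μ₁ μ₂ i 0 ↔ a = 0 := by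
  refine ⟨fun h => ?_, fun h => h ▸ rfl⟩
  have := congrFun h (⟨1, by omega⟩, 1)
  simpa [vexp, twoRowExp] using this

lemma le_tdeg_vvec (μ₁ μ₂ i : ℕ) : i ≤ tdeg (vvec hk μ₁ μ₂ i) := by
  have hmem : vexp hk μ₁ μ₂ i 0 ∈ (vvec hk μ₁ μ₂ i).support := by
    rw [Finsupp.mem_support_iff, vvec_eq, Finsupp.finsetSum_apply,
      Finset.sum_eq_single_of_mem 0 (by simp)]
    · simp [Xb, qbinom_zero]
    · intro a _ ha
      simp [Xb, vexp_eq_vexp_zero_iff, ha]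
  calc i = vexp hk μ₁ μ₂ i 0 (⟨1, by omega⟩, 0) := by simp [vexp, twoRowExp]
    _ ≤ ∑ p, vexp hk μ₁ μ₂ i 0 p :=
      Finset.single_le_sum (f := vexp hk μ₁ μ₂ i 0) (fun _ _ => Nat.zero_le _)
        (Finset.mem_univ _)
    _ ≤ tdeg (vvec hk μ₁ μ₂ i) :=
      Finset.le_sup (f := fun m : Fin k × Fin 2 → ℕ => ∑ p, m p) hmem

lemma Eop'_pow_Fop''_pow_vexp {μ₂ i a n : ℕ} (μ₁ : ℕ) (h : a + n ≤ i) (hi : i ≤ μ₂) :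
    (Eop' hk ^ n) ((Fop'' hk ^ n) (Xb (vexp hk μ₁ μ₂ i a))) =
      (qfact (μ₂ - a) / qfact (μ₂ - (a + n)) * (qfact (i - a) / qfact (i - (a + n)))) •
        Xb (vexp hk μ₁ μ₂ i (a + n)) := by
  have h1 : i - a = i - (a + n) + n := by omega
  have h2 : μ₂ - a = μ₂ - (a + n) + n := by omega
  rw [vexp, h1, h2, Fop''_pow_Xb, map_smul, Eop'_pow_Xb, smul_smul, ← h1, ← h2, add_assoc]
  rfl

/-- The coefficient identity behind the action of the quasi-`R`-matrix on `vvec`. -/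
lemma coeff_eq_altTerm {μ₂ i a n : ℕ} (h : a + n ≤ i) (hi : i ≤ μ₂) :
    qq ^ (n * (n - 1) / 2) * ((qq - qq⁻¹) ^ n / qfact n) *
        ((-1) ^ a * qbinom i a * qq ^ (a * (μ₂ - a + 1)) *
          (qfact (μ₂ - a) / qfact (μ₂ - (a + n)) * (qfact (i - a) / qfact (i - (a + n))))) =
      (-1) ^ (a + n) * qbinom i (a + n) *
        altTerm (a + n) n (qq ^ (μ₂ - (a + n) + 1)) := by
  obtain ⟨c, rfl⟩ := Nat.exists_eq_add_of_le h
  obtain ⟨M, rfl⟩ : ∃ M, μ₂ = a + n + M := Nat.exists_eq_add_of_le (by omega)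
  have e1 : a + n + M - a = M + n := by omega
  have e2 : a + n + M - (a + n) = M := by omega
  have e3 : a + n + c - a = n + c := by omega
  have e4 : a + n + c - (a + n) = c := by omega
  unfold altTerm
  rw [e2, ← qfact_div_mul_pow, e1, e3, e4, qbinom, qbinom, qbinom, e3, e4,
    Nat.add_sub_cancel]
  have h1 := qfact_ne_zero a
  have h2 := qfact_ne_zero n
  have h3 := qfact_ne_zero c
  have h4 := qfact_ne_zero M
  have h5 := qfact_ne_zero (a + n)
  have h6 := qfact_ne_zero (n + c)
  have hs : (-1 : RatFunc ℚ) ^ n * (-1) ^ n = 1 := by rw [← mul_pow]; simp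
  have hp : qq ^ (a * (M + n + 1)) = (qq ^ (M + 1)) ^ a * qq ^ (a * n) := by
    rw [← pow_mul, ← pow_add]; congr 1; ring
  rw [hp, pow_add (-1 : RatFunc ℚ), pow_add qq (a * n)]
  generalize n * (n - 1) / 2 = t
  generalize qq - qq⁻¹ = d
  field_simp
  linear_combination (-(qq ^ t * d ^ n * (qq ^ (M + 1)) ^ a * qq ^ (a * n) *
    qfact (a + n + c) * qfact (M + n))) * hs

/-- The quasi-`R`-matrix replaces `q` by `q⁻¹` in the coefficients of `vvec`. -/
lemma quasiR_vvec {μ₂ i : ℕ} (μ₁ : ℕ) (hi : i ≤ μ₂) :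
    ∑ n ∈ Finset.range (tdeg (vvec hk μ₁ μ₂ i) + 1),
      (qq ^ (n * (n - 1) / 2) * ((qq - qq⁻¹) ^ n / qfact n)) •
        ((Eop' hk ^ n) ((Fop'' hk ^ n) (vvec hk μ₁ μ₂ i))) =
    ∑ b ∈ Finset.range (i + 1),
      ((-1) ^ b * qbinom i b * (qq ^ (μ₂ - b + 1))⁻¹ ^ b) • Xb (vexp hk μ₁ μ₂ i b) := by
  set f : ℕ → ℕ → Mmod k := fun n a =>
    (qq ^ (n * (n - 1) / 2) * ((qq - qq⁻¹) ^ n / qfact n)) •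
      ((-1) ^ a * qbinom i a * qq ^ (a * (μ₂ - a + 1))) •
        ((Eop' hk ^ n) ((Fop'' hk ^ n) (Xb (vexp hk μ₁ μ₂ i a)))) with hf
  have hvanish : ∀ n a, i - a < n → f n a = 0 := fun n a h => by
    simp only [hf, vexp, Eop'_pow_Fop''_pow_Xb_of_lt hk h, smul_zero]
  have hexp : ∀ n, (qq ^ (n * (n - 1) / 2) * ((qq - qq⁻¹) ^ n / qfact n)) •
      ((Eop' hk ^ n) ((Fop'' hk ^ n) (vvec hk μ₁ μ₂ i))) =
        ∑ a ∈ Finset.range (i + 1), f n a := fun n => by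
    simp only [vvec_eq, map_sum, map_smul, Finset.smul_sum, hf]
  simp only [hexp]
  have hsub : Finset.range (i + 1) ⊆ Finset.range (tdeg (vvec hk μ₁ μ₂ i) + 1) :=
    Finset.range_subset_range.mpr (Nat.succ_le_succ (le_tdeg_vvec hk μ₁ μ₂ i))
  rw [← Finset.sum_subset hsub fun n _ hn => Finset.sum_eq_zero fun a _ =>
    hvanish n a (by simp only [Finset.mem_range] at hn; omega)]
  have hrow : ∀ n ∈ Finset.range (i + 1), ∑ a ∈ Finset.range (i + 1), f n a =
      ∑ a ∈ Finset.range (i + 1 - n), f n a := fun n hn =>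
    (Finset.sum_subset (Finset.range_subset_range.mpr (Nat.sub_le _ _)) fun a ha ha' =>
      hvanish n a (by simp only [Finset.mem_range] at hn ha ha'; omega)).symm
  rw [Finset.sum_congr rfl hrow, ← Finset.sum_range_diag_flip]
  refine Finset.sum_congr rfl fun b hb => ?_
  rw [← sum_altTerm b (pow_ne_zero _ qq_ne_zero), Finset.mul_sum, Finset.sum_smul]
  refine Finset.sum_congr rfl fun n hn => ?_
  simp only [Finset.mem_range] at hb hn
  obtain ⟨a, rfl⟩ := Nat.exists_eq_add_of_le' (Nat.lt_succ_iff.mp hn)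
  have hle : a + n ≤ i := by omega
  simp only [hf, Nat.add_sub_cancel]
  rw [Eop'_pow_Fop''_pow_vexp hk μ₁ hle hi, smul_smul, smul_smul, ← coeff_eq_altTerm hle hi]
  simp only [mul_assoc]

lemma tauOp_Qop_vexp {μ₁ μ₂ i b : ℕ} (hb : b ≤ i) (h₁ : i ≤ μ₁) (h₂ : i ≤ μ₂) :
    tauOp k (Qop k (Xb (vexp hk μ₁ μ₂ i b))) =
      qq ^ ((μ₁ - i + b) * (μ₂ - b) + (i - b) * b) • Xb (vexp hk μ₂ μ₁ i (i - b)) := by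
  rw [vexp, Qop_Xb, map_smul, tauOp_Xb, vexp]
  congr 3 <;> omega

end Operators

/-- Action of the `R`-matrix operator on the highest weight vectors:
`R v_i^{μ₁,μ₂} = (−1)^i q^{(μ₁−i)(μ₂−i)−i} v_i^{μ₂,μ₁}`. -/
theorem R_on_vvec {k : ℕ} (hk : 2 ≤ k) (μ₁ μ₂ i : ℕ)
    (hi₁ : i ≤ μ₁) (hi₂ : i ≤ μ₂) :
    Rapp hk (vvec hk μ₁ μ₂ i) =
      ((-1) ^ i * qq ^ ((((μ₁ : ℤ) - i) * ((μ₂ : ℤ) - i) - i : ℤ))) •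
        vvec hk μ₂ μ₁ i := by
  rw [Rapp, quasiR_vvec hk μ₁ hi₂, vvec_eq, Finset.smul_sum, map_sum, map_sum,
    ← Finset.sum_range_reflect]
  refine Finset.sum_congr rfl fun c hc => ?_
  have hc : c ≤ i := Nat.lt_succ_iff.mp (Finset.mem_range.mp hc)
  rw [show i + 1 - 1 - c = i - c by omega, map_smul, map_smul,
    tauOp_Qop_vexp hk (Nat.sub_le i c) hi₁ hi₂, smul_smul, smul_smul, Nat.sub_sub_self hc,
    qbinom_symm hc]
  congr 1
  obtain ⟨b, rfl⟩ := Nat.exists_eq_add_of_le hc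
  obtain ⟨l, rfl⟩ := Nat.exists_eq_add_of_le hi₁
  obtain ⟨M, rfl⟩ := Nat.exists_eq_add_of_le hi₂
  have hs : (-1 : RatFunc ℚ) ^ c * (-1) ^ c = 1 := by rw [← mul_pow]; simp
  rw [show c + b - c = b by omega, show c + b + l - (c + b) + b = l + b by omega,
    show c + b + M - b = M + c by omega, show c + b + l - c = l + b by omega]
  have hp : (qq ^ (M + c + 1))⁻¹ ^ b * qq ^ ((l + b) * (M + c) + c * b) =
      qq ^ ((((c + b + l : ℕ) : ℤ) - (c + b : ℕ)) * (((c + b + M : ℕ) : ℤ) - (c + b : ℕ)) -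
        (c + b : ℕ)) * qq ^ (c * (l + b + 1)) := by
    rw [inv_pow, ← pow_mul]
    simp only [← zpow_natCast, ← zpow_neg, ← zpow_add₀ qq_ne_zero]
    congr 1
    push_cast
    ring
  rw [mul_assoc, hp, pow_add (-1 : RatFunc ℚ)]
  linear_combination (-((-1) ^ b * qbinom (c + b) c *
    (qq ^ ((((c + b + l : ℕ) : ℤ) - (c + b : ℕ)) * (((c + b + M : ℕ) : ℤ) - (c + b : ℕ)) -
        (c + b : ℕ)) * qq ^ (c * (l + b + 1))))) * hs
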